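/- A regular language is circumfix-free if and only if its minimal biautomaton is non-exiting. -/

import Mathlib

/-- A deterministic biautomaton with the diamond-property and the F-property. -/
structure DBiA (α : Type) (Q : Type) where
  fwd : Q → α → Q
  bwd : Q → α → Q
  start : Q
  accept : Set Q
  diamond : ∀ q a b, bwd (fwd q a) b = fwd (bwd q b) a
  fprop : ∀ q a, fwd q a ∈ accept ↔ bwd q a ∈ accept

namespace DBiA

variable {α Q : Type}

/-- Extended forward transition: q·λ = q, q·(av) = (q·a)·v. -/
def fwdW (A : DBiA α Q) (q : Q) (w : List α) : Q := w.foldl A.fwd q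

/-- Extended backward transition: q∘λ = q, q∘(va) = (q∘a)∘v. -/
def bwdW (A : DBiA α Q) (q : Q) (w : List α) : Q := w.foldr (fun a p => A.bwd p a) q

/-- The language accepted by a biautomaton. -/
def lang (A : DBiA α Q) : Set (List α) := {w | A.fwdW A.start w ∈ A.accept}

end DBiA

/-- A state is a sink state if all its forward and backward transitions are self-loops. -/
def DBiA.IsSink {α Q : Type} (A : DBiA α Q) (s : Q) : Prop :=
  ∀ a : α, A.fwd s a = s ∧ A.bwd s a = s

/-- A biautomaton is non-exiting if every transition leaving an accepting state goes to
a non-accepting sink state. -/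
def DBiA.NonExiting {α Q : Type} (A : DBiA α Q) : Prop :=
  ∀ q ∈ A.accept, ∀ a : α,
    (A.fwd q a ∉ A.accept ∧ A.IsSink (A.fwd q a)) ∧
    (A.bwd q a ∉ A.accept ∧ A.IsSink (A.bwd q a))

/-- A biautomaton is non-returning if its initial state has no ingoing transitions. -/
def DBiA.NonReturning {α Q : Type} (A : DBiA α Q) : Prop :=
  ¬ ∃ (q : Q) (a : α), A.fwd q a = A.start ∨ A.bwd q a = A.start

/-- A language is circumfix-free if no word of it is a proper circumfix of another
word of it. -/
def CircumfixFree {α : Type} (L : Set (List α)) : Prop :=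
  ¬ ∃ w ∈ L, ∃ v ∈ L, w ≠ v ∧
    ∃ w₁ w₂ w₃ : List α, w = w₁ ++ w₂ ++ w₃ ∧ v = w₁ ++ w₃

namespace DBiA

variable {α Q : Type}

/-- The language accepted from a state. -/
def stateLang (A : DBiA α Q) (q : Q) : Set (List α) := {w | A.fwdW q w ∈ A.accept}

theorem bwdW_fwd (A : DBiA α Q) (q : Q) (a : α) (w : List α) :
    A.bwdW (A.fwd q a) w = A.fwd (A.bwdW q w) a := by
  induction w with
  | nil => rfl
  | cons b w ih =>
    change A.bwd (A.bwdW (A.fwd q a) w) b = A.fwd (A.bwd (A.bwdW q w) b) a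
    rw [ih, A.diamond]

theorem bwdW_fwdW (A : DBiA α Q) (q : Q) (u v : List α) :
    A.bwdW (A.fwdW q u) v = A.fwdW (A.bwdW q v) u := by
  induction u generalizing q with
  | nil => rfl
  | cons a u ih =>
    change A.bwdW (A.fwdW (A.fwd q a) u) v = A.fwdW (A.fwd (A.bwdW q v) a) u
    rw [ih, bwdW_fwd]

theorem fwdW_append (A : DBiA α Q) (q : Q) (u v : List α) :
    A.fwdW q (u ++ v) = A.fwdW (A.fwdW q u) v :=
  List.foldl_append

theorem bwdW_mem_accept_iff (A : DBiA α Q) (q : Q) (w : List α) :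
    A.bwdW q w ∈ A.accept ↔ A.fwdW q w ∈ A.accept := by
  induction w generalizing q with
  | nil => rfl
  | cons a w ih =>
    change A.bwd (A.bwdW q w) a ∈ A.accept ↔ A.fwdW (A.fwd q a) w ∈ A.accept
    rw [← A.fprop, ← bwdW_fwd, ih]

/-- The state reached by reading the prefix `u` and the suffix `v`. -/
def reach (A : DBiA α Q) (u v : List α) : Q := A.bwdW (A.fwdW A.start u) v

theorem mem_stateLang_reach (A : DBiA α Q) (u v w : List α) :
    w ∈ A.stateLang (A.reach u v) ↔ u ++ w ++ v ∈ A.lang := by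
  change A.fwdW (A.bwdW (A.fwdW A.start u) v) w ∈ A.accept ↔
    A.fwdW A.start (u ++ w ++ v) ∈ A.accept
  rw [← bwdW_fwdW, bwdW_mem_accept_iff, fwdW_append, fwdW_append]

theorem cons_mem_stateLang (A : DBiA α Q) (q : Q) (a : α) (w : List α) :
    w ∈ A.stateLang (A.fwd q a) ↔ a :: w ∈ A.stateLang q := Iff.rfl

theorem append_singleton_mem_stateLang (A : DBiA α Q) (q : Q) (a : α) (w : List α) :
    w ∈ A.stateLang (A.bwd q a) ↔ w ++ [a] ∈ A.stateLang q := by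
  change A.fwdW (A.bwdW q [a]) w ∈ A.accept ↔ A.fwdW q (w ++ [a]) ∈ A.accept
  rw [← bwdW_fwdW, bwdW_mem_accept_iff, fwdW_append]

/-- The two-sided quotients of a language. -/
def Quotients (L : Set (List α)) : Type :=
  {S : Set (List α) // ∃ u v, S = {w | u ++ w ++ v ∈ L}}

/-- The biautomaton whose states are the two-sided quotients of a language. -/
def canonical (L : Set (List α)) : DBiA α (Quotients L) where
  fwd S a := ⟨{w | a :: w ∈ S.1}, by
    obtain ⟨S, u, v, rfl⟩ := S
    exact ⟨u ++ [a], v, by simp⟩⟩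
  bwd S a := ⟨{w | w ++ [a] ∈ S.1}, by
    obtain ⟨S, u, v, rfl⟩ := S
    exact ⟨u, a :: v, by simp⟩⟩
  start := ⟨L, [], [], by simp⟩
  accept := {S | [] ∈ S.1}
  diamond _ _ _ := rfl
  fprop _ _ := Iff.rfl

theorem canonical_fwdW_mem_accept (L : Set (List α)) (S : Quotients L) (w : List α) :
    (canonical L).fwdW S w ∈ (canonical L).accept ↔ w ∈ S.1 := by
  induction w generalizing S with
  | nil => rfl
  | cons a w ih => exact ih ((canonical L).fwd S a)

theorem canonical_lang (L : Set (List α)) : (canonical L).lang = L :=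
  Set.ext fun w => canonical_fwdW_mem_accept L (canonical L).start w

/-- In a minimal biautomaton every state is reachable, and states are determined by the
languages they accept. -/
theorem reachable_and_stateLang_injective [Fintype Q] (A : DBiA α Q)
    (hmin : ∀ (Q' : Type) [Fintype Q'], ∀ B : DBiA α Q',
      B.lang = A.lang → Fintype.card Q ≤ Fintype.card Q') :
    (∀ q, ∃ u v, q = A.reach u v) ∧ Function.Injective A.stateLang := by
  classical
  choose u v huv using fun S : Quotients A.lang => S.2
  let g : Quotients A.lang → Q := fun S => A.reach (u S) (v S)
  have hg : ∀ S, A.stateLang (g S) = S.1 := fun S => by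
    rw [huv S]
    exact Set.ext fun w => A.mem_stateLang_reach (u S) (v S) w
  have hginj : Function.Injective g := fun S T h =>
    Subtype.ext (by rw [← hg S, ← hg T, h])
  let _ : Fintype (Quotients A.lang) := Fintype.ofInjective g hginj
  have hgsurj : Function.Surjective g :=
    ((Fintype.bijective_iff_injective_and_card g).2
      ⟨hginj, le_antisymm (Fintype.card_le_of_injective g hginj)
        (hmin _ (canonical A.lang) (canonical_lang A.lang))⟩).2
  refine ⟨fun q => ?_, fun p q h => ?_⟩
  · obtain ⟨S, rfl⟩ := hgsurj q
    exact ⟨u S, v S, rfl⟩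
  · obtain ⟨S, rfl⟩ := hgsurj p
    obtain ⟨T, rfl⟩ := hgsurj q
    rw [hg, hg] at h
    rw [Subtype.ext h]

theorem isSink_of_stateLang_eq_empty (A : DBiA α Q) (hinj : Function.Injective A.stateLang)
    {q : Q} (hq : A.stateLang q = ∅) : q ∉ A.accept ∧ A.IsSink q := by
  refine ⟨fun h => ?_, fun a => ⟨hinj ?_, hinj ?_⟩⟩
  · have : [] ∈ A.stateLang q := h
    simp [hq] at this
  · ext w
    rw [cons_mem_stateLang, hq]
    simp
  · ext w
    rw [append_singleton_mem_stateLang, hq]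
    simp

theorem IsSink.fwdW_eq {A : DBiA α Q} {s : Q} (hs : A.IsSink s) (w : List α) :
    A.fwdW s w = s := by
  induction w with
  | nil => rfl
  | cons a w ih =>
    change A.fwdW (A.fwd s a) w = s
    rw [(hs a).1, ih]

theorem NonExiting.circumfixFree {A : DBiA α Q} (h : A.NonExiting) :
    CircumfixFree A.lang := by
  rintro ⟨_, hw, _, hv, hne, w₁, w₂, w₃, rfl, rfl⟩
  have hq : A.reach w₁ w₃ ∈ A.accept :=
    (A.mem_stateLang_reach w₁ w₃ []).2 (by simpa using hv)
  have hw₂ := (A.mem_stateLang_reach w₁ w₃ w₂).2 hw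
  cases w₂ with
  | nil => simp at hne
  | cons a x =>
    obtain ⟨hna, hs⟩ := (h _ hq a).1
    have hx : A.fwdW (A.fwd (A.reach w₁ w₃) a) x ∈ A.accept := hw₂
    rw [hs.fwdW_eq] at hx
    exact hna hx

end DBiA

theorem CircumfixFree.eq_nil {α : Type} {L : Set (List α)} (h : CircumfixFree L)
    {u v w : List α} (huv : u ++ v ∈ L) (huwv : u ++ w ++ v ∈ L) : w = [] := by
  by_contra hw
  exact h ⟨_, huwv, _, huv, by simpa using hw, u, w, v, rfl, rfl⟩

/-- a regular language is circumfix-free iff its minimal biautomaton is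
non-exiting. -/
theorem stmt_17 {α Q : Type} [Fintype Q] (A : DBiA α Q)
    (hmin : ∀ (Q' : Type) [Fintype Q'], ∀ B : DBiA α Q',
      B.lang = A.lang → Fintype.card Q ≤ Fintype.card Q') :
    CircumfixFree A.lang ↔ A.NonExiting := by
  refine ⟨fun h q hq a => ?_, DBiA.NonExiting.circumfixFree⟩
  obtain ⟨hreach, hinj⟩ := A.reachable_and_stateLang_injective hmin
  obtain ⟨u, v, rfl⟩ := hreach q
  have huv : u ++ v ∈ A.lang := by simpa using (A.mem_stateLang_reach u v []).1 hq
  have hnil : ∀ w ∈ A.stateLang (A.reach u v), w = [] := fun w hw =>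
    h.eq_nil huv ((A.mem_stateLang_reach u v w).1 hw)
  refine ⟨A.isSink_of_stateLang_eq_empty hinj ?_, A.isSink_of_stateLang_eq_empty hinj ?_⟩
  · refine Set.eq_empty_of_forall_notMem fun w hw => ?_
    simpa using hnil _ ((A.cons_mem_stateLang _ _ _).1 hw)
  · refine Set.eq_empty_of_forall_notMem fun w hw => ?_
    simpa using hnil _ ((A.append_singleton_mem_stateLang _ _ _).1 hw)
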